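/- Let x₁,…,x_{2n+1} ∈ ℂ^{n+1} be in general position, with associated linear forms L_i(v) = Σ_{j=0}^n x_{ij} v_j. Then the rational map Φ : ℙⁿ(ℂ)×ℙⁿ(ℂ) ⇢ ℙ^{2n}(ℂ), Φ([v],[w]) = (L_1(v)/L_1(w) : ⋯ : L_{2n+1}(v)/L_{2n+1}(w)), is a birational map of ℙⁿ(ℂ)×ℙⁿ(ℂ) onto ℙ^{2n}(ℂ). Concretely: (i) there is a nonzero polynomial P on ℂ^{n+1}×ℂ^{n+1} such that whenever (v,w) and (v′,w′) satisfy P(v,w) ≠ 0, P(v′,w′) ≠ 0, and there is λ ∈ ℂ∖{0} with L_i(v)·L_i(w′) = λ·L_i(v′)·L_i(w) for all i = 1,…,2n+1, then v and v′ are proportional and w and w′ are proportional; and (ii) there is a nonzero polynomial R on ℂ^{2n+1} such that for every u = (u₁,…,u_{2n+1}) with R(u) ≠ 0 there exist v, w ∈ ℂ^{n+1} with L_i(w) ≠ 0 and L_i(v) = u_i·L_i(w) for all i = 1,…,2n+1. (Proposition 2.1, after Fujimoto.) -/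

import Mathlib

noncomputable section

/-- The vectors `x 0, …, x (q-1)` in `ℂ^{n+1}` are in general position:
any `n + 1` of them are linearly independent. -/
def GenPos (n q : ℕ) (x : Fin q → Fin (n + 1) → ℂ) : Prop :=
  ∀ s : Finset (Fin q), s.card = n + 1 → LinearIndependent ℂ (fun i : s => x i.1)

section GenericFiber

open scoped Matrix

/-- A vector on which `n + 1` of the forms in general position vanish is zero. -/
lemma GenPos.eq_zero_of_dotProduct_eq_zero {n q : ℕ} {x : Fin q → Fin (n + 1) → ℂ}
    (hx : GenPos n q x) {s : Finset (Fin q)} (hs : s.card = n + 1) {v : Fin (n + 1) → ℂ}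
    (hv : ∀ i ∈ s, x i ⬝ᵥ v = 0) : v = 0 := by
  have hspan : Submodule.span ℂ (Set.range fun i : s => x i.1) = ⊤ :=
    (hx s hs).span_eq_top_of_card_eq_finrank' (by simp [hs])
  refine dotProduct_eq_zero v fun y => ?_
  have hy : y ∈ Submodule.span ℂ (Set.range fun i : s => x i.1) := hspan ▸ Submodule.mem_top
  rw [dotProduct_comm]
  induction hy using Submodule.span_induction with
  | mem y h => obtain ⟨i, rfl⟩ := h; exact hv i.1 i.2
  | zero => simp
  | add y z _ _ hy hz => rw [add_dotProduct, hy, hz, add_zero]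
  | smul a y _ hy => rw [smul_dotProduct, hy, smul_zero]

/-- Given `n` of the forms in general position, there is a vector on which precisely
these forms vanish. -/
lemma GenPos.exists_dotProduct_eq_zero_iff {n q : ℕ} {x : Fin q → Fin (n + 1) → ℂ}
    (hx : GenPos n q x) {s : Finset (Fin q)} (hs : s.card = n) :
    ∃ v : Fin (n + 1) → ℂ, ∀ i, x i ⬝ᵥ v = 0 ↔ i ∈ s := by
  let f : (Fin (n + 1) → ℂ) →ₗ[ℂ] (s → ℂ) := Matrix.mulVecLin (Matrix.of fun i : s => x i.1)
  have hker : LinearMap.ker f ≠ ⊥ := LinearMap.ker_ne_bot_of_finrank_lt (by simp [hs])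
  obtain ⟨v, hv, hv0⟩ := Submodule.exists_mem_ne_zero_of_ne_bot hker
  have hvs : ∀ i ∈ s, x i ⬝ᵥ v = 0 := fun i hi => congrFun hv ⟨i, hi⟩
  refine ⟨v, fun i => ⟨fun hi => ?_, hvs i⟩⟩
  by_contra his
  refine hv0 (hx.eq_zero_of_dotProduct_eq_zero (s := insert i s) (by simp [his, hs]) ?_)
  intro k hk
  rcases Finset.mem_insert.1 hk with rfl | hk
  exacts [hi, hvs k hk]

/-- There is a point `u` over which the linear system `L_i(v) = u_i L_i(w)` has a one-dimensional
solution space, spanned by a pair `(v, w)` with no `L_i(w)` vanishing. -/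
lemma GenPos.exists_unique_fiber {n : ℕ} {x : Fin (2 * n + 1) → Fin (n + 1) → ℂ}
    (hx : GenPos n (2 * n + 1) x) :
    ∃ (c : Fin (2 * n + 1)) (u : Fin (2 * n + 1) → ℂ) (v₀ w₀ : Fin (n + 1) → ℂ),
      (∀ i, x i ⬝ᵥ w₀ ≠ 0) ∧ (∀ i, x i ⬝ᵥ v₀ = u i * (x i ⬝ᵥ w₀)) ∧
      ∀ v w : Fin (n + 1) → ℂ, (∀ i, x i ⬝ᵥ v = u i * (x i ⬝ᵥ w)) → x c ⬝ᵥ v = 0 →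
        v = 0 ∧ w = 0 := by
  classical
  obtain ⟨c⟩ : Nonempty (Fin (2 * n + 1)) := inferInstance
  obtain ⟨A, hA, hAc⟩ := Finset.exists_subset_card_eq
    (s := Finset.univ.erase c) (n := n) (by simp; omega)
  have hcA : c ∉ A := fun h => by simpa using hA h
  set B := (insert c A)ᶜ with hB
  have hBc : B.card = n := by
    rw [hB, Finset.card_compl, Finset.card_insert_of_notMem hcA, hAc, Fintype.card_fin]; omega
  have hmemB : ∀ i, i ∈ B ↔ i ≠ c ∧ i ∉ A := by simp [hB]
  obtain ⟨a, ha⟩ := hx.exists_dotProduct_eq_zero_iff hAc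
  obtain ⟨b, hb⟩ := hx.exists_dotProduct_eq_zero_iff hBc
  have hac : x c ⬝ᵥ a ≠ 0 := fun h => hcA ((ha c).1 h)
  have hcB : c ∉ B := by simp [hmemB]
  have hbc : x c ⬝ᵥ b ≠ 0 := fun h => hcB ((hb c).1 h)
  have hw : ∀ i, x i ⬝ᵥ (b - (x c ⬝ᵥ b / (2 * (x c ⬝ᵥ a))) • a)
      = x i ⬝ᵥ b - x c ⬝ᵥ b / (2 * (x c ⬝ᵥ a)) * (x i ⬝ᵥ a) := fun i => by
    rw [dotProduct_sub, dotProduct_smul, smul_eq_mul]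
  refine ⟨c, fun i => if i = c then 2 else if i ∈ A then 1 else 0, b,
    b - (x c ⬝ᵥ b / (2 * (x c ⬝ᵥ a))) • a, fun i => ?_, fun i => ?_, fun v w h hc => ?_⟩
  · rw [hw]
    by_cases hic : i = c
    · subst hic
      have : x i ⬝ᵥ b - x i ⬝ᵥ b / (2 * (x i ⬝ᵥ a)) * (x i ⬝ᵥ a) = x i ⬝ᵥ b / 2 := by
        field_simp; ring
      rw [this]
      exact div_ne_zero hbc two_ne_zero
    by_cases hiA : i ∈ A
    · rw [(ha i).2 hiA, mul_zero, sub_zero, Ne, hb, hmemB]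
      tauto
    · rw [(hb i).2 ((hmemB i).2 ⟨hic, hiA⟩), zero_sub, neg_ne_zero]
      exact mul_ne_zero (div_ne_zero hbc (mul_ne_zero two_ne_zero hac)) fun h => hiA ((ha i).1 h)
  · rw [hw]
    by_cases hic : i = c
    · subst hic
      simp only [if_true]
      field_simp
      ring
    by_cases hiA : i ∈ A
    · simp [hic, hiA, (ha i).2 hiA]
    · simp [hic, hiA, (hb i).2 ((hmemB i).2 ⟨hic, hiA⟩)]
  · have hv : v = 0 := by
      refine hx.eq_zero_of_dotProduct_eq_zero (s := insert c B) (by simp [hcB, hBc]) fun i hi => ?_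
      rcases Finset.mem_insert.1 hi with rfl | hi
      · exact hc
      · simp [h i, (hmemB i).1 hi]
    subst hv
    refine ⟨rfl, hx.eq_zero_of_dotProduct_eq_zero (s := insert c A) (by simp [hcA, hAc])
      fun i hi => ?_⟩
    have hi' := h i
    rw [dotProduct_zero] at hi'
    rcases Finset.mem_insert.1 hi with rfl | hi
    · simpa using hi'.symm
    · by_cases hic : i = c
      · exact absurd (hic ▸ hi) hcA
      · simpa [hic, hi] using hi'.symm

/-- The square matrix of the linear system `p_i L_i(v) = q_i L_i(w)` in the unknowns `(v, w)`,
completed by the row of the linear form `L_c(v)`; the rows are indexed through `e`. -/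
def fiberMatrix {R ι κ : Type*} [CommRing R] (e : κ ⊕ κ ≃ Option ι) (x : ι → κ → R) (c : ι)
    (p q : ι → R) : Matrix (κ ⊕ κ) (κ ⊕ κ) R :=
  Matrix.of fun s => (e s).elim (Sum.elim (x c) 0) fun i => Sum.elim (p i • x i) (-(q i • x i))

section fiberMatrix

variable {R ι κ : Type*} [CommRing R] (e : κ ⊕ κ ≃ Option ι) (x : ι → κ → R) (c : ι) (p q : ι → R)

lemma fiberMatrix_map {S : Type*} [CommRing S] (f : R →+* S) :
    (fiberMatrix e x c p q).map f
      = fiberMatrix e (fun i j => f (x i j)) c (fun i => f (p i)) (fun i => f (q i)) := by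
  ext s t
  rcases h : e s with _ | i <;> rcases t with t | t <;> simp [fiberMatrix, h]

variable [Fintype κ] (v w : κ → R)

lemma fiberMatrix_mulVec_none :
    (fiberMatrix e x c p q *ᵥ Sum.elim v w) (e.symm none) = x c ⬝ᵥ v := by
  simp [fiberMatrix, Matrix.mulVec, dotProduct]

lemma fiberMatrix_mulVec_some (i : ι) :
    (fiberMatrix e x c p q *ᵥ Sum.elim v w) (e.symm (some i))
      = p i * (x i ⬝ᵥ v) - q i * (x i ⬝ᵥ w) := by
  simp [fiberMatrix, Matrix.mulVec, dotProduct, Finset.mul_sum, mul_assoc, sub_eq_add_neg]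

lemma fiberMatrix_mulVec_eq_zero_iff :
    fiberMatrix e x c p q *ᵥ Sum.elim v w = 0 ↔
      x c ⬝ᵥ v = 0 ∧ ∀ i, p i * (x i ⬝ᵥ v) = q i * (x i ⬝ᵥ w) := by
  rw [← fiberMatrix_mulVec_none e x c p q v w]
  simp only [← sub_eq_zero (b := q _ * _), ← fiberMatrix_mulVec_some e x c p q v w]
  rw [funext_iff, e.symm.surjective.forall, Option.forall]
  rfl

variable [DecidableEq κ]

lemma det_fiberMatrix_ne_zero_iff [IsDomain R] :
    (fiberMatrix e x c p q).det ≠ 0 ↔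
      ∀ v w : κ → R, (∀ i, p i * (x i ⬝ᵥ v) = q i * (x i ⬝ᵥ w)) → x c ⬝ᵥ v = 0 →
        v = 0 ∧ w = 0 := by
  rw [Ne, ← Matrix.exists_mulVec_eq_zero_iff]
  push Not
  constructor
  · intro h v w hvw hc
    by_contra hne
    refine h (Sum.elim v w) (fun h0 => hne ⟨?_, ?_⟩)
      ((fiberMatrix_mulVec_eq_zero_iff e x c p q v w).2 ⟨hc, hvw⟩)
    · exact funext fun j => congrFun h0 (Sum.inl j)
    · exact funext fun j => congrFun h0 (Sum.inr j)
  · intro h z hz0 hz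
    rw [← Sum.elim_comp_inl_inr z, fiberMatrix_mulVec_eq_zero_iff] at hz
    obtain ⟨h1, h2⟩ := h _ _ hz.2 hz.1
    exact hz0 (by rw [← Sum.elim_comp_inl_inr z, h1, h2]; ext (j | j) <;> rfl)

/-- The solution of the linear system `p_i L_i(v) = q_i L_i(w)` given by minors. -/
def fiberVec : κ ⊕ κ → R :=
  fun s => (fiberMatrix e x c p q).adjugate s (e.symm none)

lemma fiberMatrix_mulVec_fiberVec :
    fiberMatrix e x c p q *ᵥ Sum.elim (fun j => fiberVec e x c p q (Sum.inl j))
        (fun j => fiberVec e x c p q (Sum.inr j))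
      = Pi.single (e.symm none) (fiberMatrix e x c p q).det := by
  have h : Sum.elim (fun j => fiberVec e x c p q (Sum.inl j))
      (fun j => fiberVec e x c p q (Sum.inr j)) = fiberVec e x c p q :=
    Sum.elim_comp_inl_inr (fiberVec e x c p q)
  rw [h]
  ext s
  have := congrFun (congrFun (Matrix.mul_adjugate (fiberMatrix e x c p q)) s) (e.symm none)
  rw [Matrix.mul_apply] at this
  simpa [Matrix.mulVec, dotProduct, fiberVec, Pi.single_apply, Matrix.one_apply] using this

lemma dotProduct_fiberVec :
    x c ⬝ᵥ (fun j => fiberVec e x c p q (Sum.inl j)) = (fiberMatrix e x c p q).det := by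
  rw [← fiberMatrix_mulVec_none e x c p q _ (fun j => fiberVec e x c p q (Sum.inr j)),
    fiberMatrix_mulVec_fiberVec, Pi.single_eq_same]

lemma mul_dotProduct_fiberVec (i : ι) :
    p i * (x i ⬝ᵥ fun j => fiberVec e x c p q (Sum.inl j))
      = q i * (x i ⬝ᵥ fun j => fiberVec e x c p q (Sum.inr j)) := by
  rw [← sub_eq_zero, ← fiberMatrix_mulVec_some e x c p q, fiberMatrix_mulVec_fiberVec,
    Pi.single_eq_of_ne (by simp)]

lemma map_fiberVec {S : Type*} [CommRing S] (f : R →+* S) (s : κ ⊕ κ) :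
    f (fiberVec e x c p q s)
      = fiberVec e (fun i j => f (x i j)) c (fun i => f (p i)) (fun i => f (q i)) s := by
  rw [fiberVec, fiberVec, ← fiberMatrix_map, ← RingHom.mapMatrix_apply, ← RingHom.map_adjugate]
  rfl

end fiberMatrix

/-- If the completed linear system is nondegenerate, the solutions of `p_i L_i(v) = q_i L_i(w)`
are all multiples of a given nonzero one. -/
lemma exists_smul_of_det_fiberMatrix_ne_zero {K ι κ : Type*} [Field K] [Fintype κ] [DecidableEq κ]
    {e : κ ⊕ κ ≃ Option ι} {x : ι → κ → K} {c : ι} {p q : ι → K}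
    (hdet : (fiberMatrix e x c p q).det ≠ 0) {v w v' w' : κ → K}
    (h : ∀ i, p i * (x i ⬝ᵥ v) = q i * (x i ⬝ᵥ w))
    (h' : ∀ i, p i * (x i ⬝ᵥ v') = q i * (x i ⬝ᵥ w')) (hne : ¬ (v = 0 ∧ w = 0)) :
    ∃ a : K, v' = a • v ∧ w' = a • w := by
  rw [det_fiberMatrix_ne_zero_iff] at hdet
  have hc : x c ⬝ᵥ v ≠ 0 := fun h0 => hne (hdet v w h h0)
  obtain ⟨h1, h2⟩ := hdet (v' - (x c ⬝ᵥ v' / x c ⬝ᵥ v) • v) (w' - (x c ⬝ᵥ v' / x c ⬝ᵥ v) • w)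
    (fun i => by
      simp only [dotProduct_sub, dotProduct_smul, smul_eq_mul]
      linear_combination h' i - (x c ⬝ᵥ v' / x c ⬝ᵥ v) * h i)
    (by
      simp only [dotProduct_sub, dotProduct_smul, smul_eq_mul]
      field_simp
      ring)
  exact ⟨_, sub_eq_zero.1 h1, sub_eq_zero.1 h2⟩

end GenericFiber

/-- **Proposition 2.1 (after Fujimoto).** For `x₁, …, x_{2n+1} ∈ ℂ^{n+1}` in
general position with linear forms `L_i(v) = Σ_j x_{ij} v_j`, the rational map
`Φ([v],[w]) = (L_1(v)/L_1(w) : ⋯ : L_{2n+1}(v)/L_{2n+1}(w))` is a birational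
map of `ℙⁿ(ℂ) × ℙⁿ(ℂ)` onto `ℙ^{2n}(ℂ)`, expressed concretely by (i) generic
injectivity up to scalars and (ii) generic surjectivity. -/
theorem prop_2_1_birational
    (n : ℕ)
    (x : Fin (2 * n + 1) → Fin (n + 1) → ℂ)
    (hGP : GenPos n (2 * n + 1) x) :
    (∃ P : MvPolynomial (Fin (n + 1) ⊕ Fin (n + 1)) ℂ, P ≠ 0 ∧
      ∀ v w v' w' : Fin (n + 1) → ℂ,
        MvPolynomial.eval (Sum.elim v w) P ≠ 0 →
        MvPolynomial.eval (Sum.elim v' w') P ≠ 0 →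
        (∃ lam : ℂ, lam ≠ 0 ∧ ∀ i : Fin (2 * n + 1),
          (∑ j, x i j * v j) * (∑ j, x i j * w' j)
            = lam * ((∑ j, x i j * v' j) * (∑ j, x i j * w j))) →
        ((∃ c : ℂ, c ≠ 0 ∧ ∀ j, v' j = c * v j) ∧
          (∃ c : ℂ, c ≠ 0 ∧ ∀ j, w' j = c * w j))) ∧
    (∃ R : MvPolynomial (Fin (2 * n + 1)) ℂ, R ≠ 0 ∧
      ∀ u : Fin (2 * n + 1) → ℂ, MvPolynomial.eval u R ≠ 0 →
        ∃ v w : Fin (n + 1) → ℂ, ∀ i : Fin (2 * n + 1),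
          (∑ j, x i j * w j) ≠ 0 ∧ (∑ j, x i j * v j) = u i * (∑ j, x i j * w j)) := by
  classical
  obtain ⟨c, u₀, v₀, w₀, hw₀, hvw₀, huniq⟩ := hGP.exists_unique_fiber
  obtain ⟨e⟩ : Nonempty (Fin (n + 1) ⊕ Fin (n + 1) ≃ Option (Fin (2 * n + 1))) :=
    ⟨Fintype.equivOfCardEq (by simp; omega)⟩
  constructor
  · let P := (fiberMatrix e (fun i j => MvPolynomial.C (x i j)) c
      (fun i => ∑ j, MvPolynomial.C (x i j) * MvPolynomial.X (Sum.inr j))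
      (fun i => ∑ j, MvPolynomial.C (x i j) * MvPolynomial.X (Sum.inl j)) :
        Matrix _ _ (MvPolynomial (Fin (n + 1) ⊕ Fin (n + 1)) ℂ)).det
    have hP : ∀ v w, MvPolynomial.eval (Sum.elim v w) P
        = (fiberMatrix e x c (fun i => x i ⬝ᵥ w) (fun i => x i ⬝ᵥ v)).det := fun v w => by
      rw [RingHom.map_det, RingHom.mapMatrix_apply, fiberMatrix_map]
      simp [dotProduct]
    have hne : ∀ v w, MvPolynomial.eval (Sum.elim v w) P ≠ 0 → ¬ (v = 0 ∧ w = 0) := by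
      rintro v w h ⟨rfl, rfl⟩
      rw [hP, det_fiberMatrix_ne_zero_iff] at h
      have := (h 0 (fun _ => 1) (by simp) (by simp)).2
      exact one_ne_zero (congrFun this 0)
    refine ⟨P, fun h0 => ?_, ?_⟩
    · have : MvPolynomial.eval (Sum.elim v₀ w₀) P ≠ 0 := by
        rw [hP, det_fiberMatrix_ne_zero_iff]
        refine fun v w h => huniq v w fun i => mul_left_cancel₀ (hw₀ i) ?_
        rw [h i, hvw₀ i]
        ring
      exact this (by rw [h0, map_zero])
    · rintro v w v' w' h h' ⟨lam, hlam, heq⟩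
      obtain ⟨a, ha, ha'⟩ := exists_smul_of_det_fiberMatrix_ne_zero (hP v w ▸ h)
        (v := v) (w := w) (v' := lam • v') (w' := w') (fun i => mul_comm _ _)
        (fun i => by
          rw [dotProduct_smul, smul_eq_mul]
          exact (by ring : _ = lam * ((x i ⬝ᵥ v') * (x i ⬝ᵥ w))).trans (heq i).symm) (hne v w h)
      have hv' : v' = (a / lam) • v := by
        rw [div_eq_inv_mul, mul_smul, ← ha, inv_smul_smul₀ hlam]
      have ha0 : a ≠ 0 := by
        rintro rfl
        exact hne v' w' h' ⟨by simpa using hv', by simpa using ha'⟩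
      exact ⟨⟨a / lam, div_ne_zero ha0 hlam, congrFun hv'⟩, ⟨a, ha0, congrFun ha'⟩⟩
  · let z : Fin (n + 1) ⊕ Fin (n + 1) → MvPolynomial (Fin (2 * n + 1)) ℂ :=
      fiberVec e (fun i j => MvPolynomial.C (x i j)) c (fun _ => 1) MvPolynomial.X
    have hz : ∀ u s, MvPolynomial.eval u (z s) = fiberVec e x c (fun _ => 1) u s := fun u s => by
      simp [z, map_fiberVec]
    let R := ∏ i, ∑ j, MvPolynomial.C (x i j) * z (Sum.inr j)
    have hR : ∀ u, MvPolynomial.eval u R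
        = ∏ i, x i ⬝ᵥ fun j => fiberVec e x c (fun _ => 1) u (Sum.inr j) := fun u => by
      simp [R, hz, dotProduct, map_prod]
    refine ⟨R, fun h0 => ?_, fun u hu => ?_⟩
    · have hdet : (fiberMatrix e x c (fun _ => 1) u₀).det ≠ 0 := by
        rw [det_fiberMatrix_ne_zero_iff]
        simpa using huniq
      obtain ⟨a, ha, ha'⟩ := exists_smul_of_det_fiberMatrix_ne_zero hdet (v := v₀) (w := w₀)
        (by simpa using hvw₀) (mul_dotProduct_fiberVec e x c (fun _ => 1) u₀)
        (fun h => hw₀ c (by rw [h.2, dotProduct_zero]))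
      have ha0 : a ≠ 0 := by
        rintro rfl
        rw [← dotProduct_fiberVec, ha] at hdet
        simp at hdet
      have : MvPolynomial.eval u₀ R ≠ 0 := by
        rw [hR, ha']
        refine Finset.prod_ne_zero_iff.2 fun i _ => ?_
        rw [dotProduct_smul]
        exact smul_ne_zero ha0 (hw₀ i)
      exact this (by rw [h0, map_zero])
    · rw [hR, Finset.prod_ne_zero_iff] at hu
      refine ⟨fun j => fiberVec e x c (fun _ => 1) u (Sum.inl j),
        fun j => fiberVec e x c (fun _ => 1) u (Sum.inr j),
        fun i => ⟨hu i (Finset.mem_univ i), ?_⟩⟩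
      have := mul_dotProduct_fiberVec e x c (fun _ => 1) u i
      rwa [one_mul] at this
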